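/- Define a local set of a finite simple graph G as a nonempty set of the form D ∪ Odd(D) for some nonempty D ⊆ V, where Odd(D) is the set of vertices with an odd number of neighbors in D. A minimal local set is a local set containing no other local set. Then every vertex of G belongs to at least one minimal local set. -/

import Mathlib

open scoped Classical

/-- The odd neighborhood of a set `D` of vertices: the vertices having an odd
number of neighbors in `D`. -/
noncomputable def oddN {V : Type*} [Fintype V] (G : SimpleGraph V) (D : Finset V) :
    Finset V :=
  Finset.univ.filter fun v => Odd (D.filter fun d => G.Adj v d).card

/-- A local set of `G`: a set of the form `D ∪ Odd(D)` for some nonempty `D`. -/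
noncomputable def IsLocalSet {V : Type*} [Fintype V] (G : SimpleGraph V)
    (L : Finset V) : Prop :=
  ∃ D : Finset V, D.Nonempty ∧ L = D ∪ oddN G D

/-- A minimal local set: a local set containing no other local set. -/
noncomputable def IsMinimalLocalSet {V : Type*} [Fintype V] (G : SimpleGraph V)
    (L : Finset V) : Prop :=
  IsLocalSet G L ∧ ∀ L' : Finset V, IsLocalSet G L' → L' ⊆ L → L' = L


/-- The adjacency operator over `ZMod 2`. -/
noncomputable def adjL {V : Type*} [Fintype V] (G : SimpleGraph V) :
    (V → ZMod 2) →ₗ[ZMod 2] (V → ZMod 2) := (G.adjMatrix (ZMod 2)).mulVecLin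

/-- The vector `x` and its image are supported in `X`. -/
def Supp {V : Type*} [Fintype V] (G : SimpleGraph V) (X : Finset V) (x : V → ZMod 2) : Prop :=
  ∀ i, i ∉ X → x i = 0 ∧ adjL G x i = 0

/-- No nonzero vector is supported in `X`. -/
def Full {V : Type*} [Fintype V] (G : SimpleGraph V) (X : Finset V) : Prop :=
  ∀ x, Supp G X x → x = 0

theorem adjL_symm {V : Type*} [Fintype V] (G : SimpleGraph V) (x y : V → ZMod 2) :
    ∑ i, x i * adjL G y i = ∑ i, adjL G x i * y i := by
  have h := Matrix.dotProduct_mulVec x (G.adjMatrix (ZMod 2)) y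
  rw [← Matrix.mulVec_transpose, SimpleGraph.transpose_adjMatrix] at h
  exact h

theorem adjL_filter {V : Type*} [Fintype V] (G : SimpleGraph V) (x : V → ZMod 2) (i : V) :
    adjL G x i = (((Finset.univ.filter fun d => x d ≠ 0).filter fun d => G.Adj i d).card : ZMod 2) := by
  have h01 : ∀ a : ZMod 2, a = if a ≠ 0 then 1 else 0 := by decide
  rw [Finset.card_eq_sum_ones, Nat.cast_sum, Finset.sum_filter, Finset.sum_filter]
  simp only [adjL, Matrix.mulVecLin_apply, Matrix.mulVec, dotProduct]
  refine Finset.sum_congr rfl fun d _ => ?_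
  rw [SimpleGraph.adjMatrix_apply]
  have hx := h01 (x d)
  by_cases h1 : x d = 0
  · simp [h1]
  · rw [if_pos h1] at hx
    simp [hx]

theorem mem_oddN_iff {V : Type*} [Fintype V] (G : SimpleGraph V) (x : V → ZMod 2) (i : V) :
    i ∈ oddN G (Finset.univ.filter fun d => x d ≠ 0) ↔ adjL G x i ≠ 0 := by
  rw [adjL_filter, ZMod.natCast_ne_zero_iff_odd]
  simp [oddN]

theorem not_full_iff {V : Type*} [Fintype V] (G : SimpleGraph V) (X : Finset V) :
    ¬ Full G X ↔ ∃ L, IsLocalSet G L ∧ L ⊆ X := by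
  constructor
  · intro h
    simp only [Full, not_forall] at h
    obtain ⟨x, hx, hx0⟩ := h
    obtain ⟨i, hi⟩ := Function.ne_iff.1 hx0
    refine ⟨_, ⟨Finset.univ.filter fun d => x d ≠ 0, ⟨i, by simpa using hi⟩, rfl⟩, ?_⟩
    intro j hj
    by_contra hjX
    obtain ⟨h1, h2⟩ := hx j hjX
    rw [Finset.mem_union, mem_oddN_iff] at hj
    simp [h1, h2] at hj
  · rintro ⟨L, ⟨D, ⟨d, hd⟩, rfl⟩, hL⟩ hf
    have hD : (Finset.univ.filter fun d => (if d ∈ D then (1 : ZMod 2) else 0) ≠ 0) = D := by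
      ext; simp
    have := hf (fun d => if d ∈ D then 1 else 0) (fun i hi => by
      constructor
      · have : i ∉ D := fun h => hi (hL (Finset.mem_union_left _ h))
        simp [this]
      · by_contra h
        rw [← ne_eq, ← mem_oddN_iff, hD] at h
        exact hi (hL (Finset.mem_union_right _ h)))
    have := congrFun this d
    simp [hd] at this

/-- Restriction of the vector and its image to `X`. -/
noncomputable def res {V : Type*} [Fintype V] (G : SimpleGraph V) (X : Finset V) :
    (V → ZMod 2) →ₗ[ZMod 2] ((X → ZMod 2) × (X → ZMod 2)) :=
  (LinearMap.funLeft (ZMod 2) (ZMod 2) (Subtype.val : X → V)).prod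
    ((LinearMap.funLeft (ZMod 2) (ZMod 2) (Subtype.val : X → V)).comp (adjL G))

/-- The standard symplectic form. -/
noncomputable def omg (ι : Type*) [Fintype ι] :
    LinearMap.BilinForm (ZMod 2) ((ι → ZMod 2) × (ι → ZMod 2)) :=
  LinearMap.mk₂ (ZMod 2) (fun p q => ∑ i, (p.1 i * q.2 i + p.2 i * q.1 i))
    (by intro a b c; rw [← Finset.sum_add_distrib]; congr; ext; simp; ring)
    (by intro a b c; simp only [smul_eq_mul, Finset.mul_sum]; congr; ext; simp; ring)
    (by intro a b c; rw [← Finset.sum_add_distrib]; congr; ext; simp; ring)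
    (by intro a b c; simp only [smul_eq_mul, Finset.mul_sum]; congr; ext; simp; ring)

theorem omg_apply (ι : Type*) [Fintype ι] (p q : (ι → ZMod 2) × (ι → ZMod 2)) :
    omg ι p q = ∑ i, (p.1 i * q.2 i + p.2 i * q.1 i) := rfl

theorem omg_symm (ι : Type*) [Fintype ι] : (omg ι).IsSymm := by
  refine ⟨fun p q => ?_⟩
  simp only [omg_apply, RingHom.id_apply]
  exact Finset.sum_congr rfl fun i _ => by ring

theorem omg_sep (ι : Type*) [Fintype ι] (p : (ι → ZMod 2) × (ι → ZMod 2))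
    (h : ∀ q, omg ι p q = 0) : p = 0 := by
  ext i
  · have := h (0, Pi.single i 1)
    simpa [omg_apply, Pi.single_apply] using this
  · have := h (Pi.single i 1, 0)
    simpa [omg_apply, Pi.single_apply] using this

theorem omg_nondeg (ι : Type*) [Fintype ι] : (omg ι).Nondegenerate :=
  (omg_symm ι).isRefl.nondegenerate_iff_separatingLeft.2 (omg_sep ι)

theorem isotropic_le (ι : Type*) [Fintype ι]
    (W : Submodule (ZMod 2) ((ι → ZMod 2) × (ι → ZMod 2)))
    (h : ∀ p ∈ W, ∀ q ∈ W, omg ι p q = 0) :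
    Module.finrank (ZMod 2) W ≤ Fintype.card ι := by
  have h1 := LinearMap.BilinForm.finrank_orthogonal (omg_nondeg ι) W
  have h2 : W ≤ (omg ι).orthogonal W := fun q hq p hp => h p hp q hq
  have h3 := Submodule.finrank_mono h2
  have h4 := Submodule.finrank_le W
  simp only [Module.finrank_prod, Module.finrank_fintype_fun_eq_card] at h1 h4
  omega

theorem omg_res {V : Type*} [Fintype V] (G : SimpleGraph V) (X : Finset V) (x y : V → ZMod 2) :
    omg X (res G X x) (res G X y) = ∑ i ∈ X, (x i * adjL G y i + adjL G x i * y i) := by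
  rw [omg_apply]
  exact Finset.sum_coe_sort X (fun i => (x i * adjL G y i + adjL G x i * y i))

theorem omg_univ {V : Type*} [Fintype V] (G : SimpleGraph V) (x y : V → ZMod 2) :
    ∑ i, (x i * adjL G y i + adjL G x i * y i) = 0 := by
  rw [Finset.sum_add_distrib, adjL_symm]
  exact CharTwo.add_self_eq_zero _

theorem res_surj {V : Type*} [Fintype V] (G : SimpleGraph V) (X : Finset V) (hX : Full G X) :
    LinearMap.range (res G X) = ⊤ := by
  have h1 := LinearMap.BilinForm.finrank_orthogonal (omg_nondeg X) (LinearMap.range (res G X))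
  have h2 : (omg X).orthogonal (LinearMap.range (res G X)) = ⊥ := by
    rw [eq_bot_iff]
    intro p hp
    let q : V → ZMod 2 := fun i => if h : i ∈ X then p.1 ⟨i, h⟩ else 0
    let r : V → ZMod 2 := fun i => if h : i ∈ X then p.2 ⟨i, h⟩ else 0
    have key : ∀ x : V → ZMod 2, ∑ i, x i * (r i + adjL G q i) = 0 := by
      intro x
      have := hp (res G X x) ⟨x, rfl⟩
      change omg X (res G X x) p = 0 at this
      rw [omg_apply] at this
      have e : ∑ i : X, ((res G X x).1 i * p.2 i + (res G X x).2 i * p.1 i)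
          = ∑ i ∈ X, (x i * r i + adjL G x i * q i) := by
        rw [← Finset.sum_coe_sort X]
        refine Finset.sum_congr rfl fun i _ => ?_
        simp [q, r, res, LinearMap.funLeft]
      rw [e, Finset.sum_subset (Finset.subset_univ X)
        (fun i _ hi => by simp [q, r, hi])] at this
      simp only [mul_add, Finset.sum_add_distrib] at this ⊢
      rw [adjL_symm]; exact this
    have hz : ∀ i, r i + adjL G q i = 0 := fun i => by
      simpa [Pi.single_apply] using key (Pi.single i 1)
    have hq : q = 0 := hX q fun i hi => by
      refine ⟨by simp [q, hi], ?_⟩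
      have := hz i
      simpa [r, hi] using this
    have hr : r = 0 := by
      ext i
      simpa [hq] using hz i
    rw [Submodule.mem_bot]
    ext i
    · simpa [q] using congrFun hq i
    · simpa [r] using congrFun hr i
  rw [h2, finrank_bot] at h1
  have h4 := Submodule.finrank_le (LinearMap.range (res G X))
  exact Submodule.eq_top_of_finrank_eq (by omega)

theorem main_contra {V : Type*} [Fintype V] (G : SimpleGraph V) (B : Finset V) (v : V)
    (hv : v ∉ B) (hA : Full G (insert v B))
    (hw : ∀ w, w ∉ insert v B → ¬ Full G (insert w B)) : False := by
  have hB : Full G B := fun x hx => hA x fun i hi => hx i fun h => hi (Finset.mem_insert_of_mem h)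
  let W := {w // w ∉ insert v B}
  have hex : ∀ w : W, ∃ x, Supp G (insert w.1 B) x ∧ x ≠ 0 := fun w => by
    have := hw w.1 w.2
    simpa [Full] using this
  choose u hu hu0 using hex
  have hne : ∀ w : W, ¬ (u w w.1 = 0 ∧ adjL G (u w) w.1 = 0) := fun w h =>
    hu0 w (hB _ fun i hi => by
      by_cases e : i = w.1
      · rw [e]; exact h
      · exact hu w i (by simp [e, hi]))
  let Φ : (W → ZMod 2) →ₗ[ZMod 2] (V → ZMod 2) := Fintype.linearCombination (ZMod 2) u
  have hΦ : ∀ c, Φ c = ∑ w, c w • u w := fun c => Fintype.linearCombination_apply _ _ _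
  have hoff : ∀ w w' : W, w ≠ w' → u w w'.1 = 0 ∧ adjL G (u w) w'.1 = 0 := fun w w' h =>
    hu w _ (by
      have := w'.2
      simp only [Finset.mem_insert, not_or] at this ⊢
      exact ⟨fun e => h (Subtype.ext e.symm), this.2⟩)
  have hinj : Function.Injective Φ := by
    rw [← LinearMap.ker_eq_bot, LinearMap.ker_eq_bot']
    intro c hc
    ext w
    have e1 : Φ c w.1 = c w * u w w.1 := by
      rw [hΦ, Finset.sum_apply, Finset.sum_eq_single w]
      · rfl
      · intro b _ hb; simp [(hoff b w hb).1]
      · simp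
    have e2 : adjL G (Φ c) w.1 = c w * adjL G (u w) w.1 := by
      rw [hΦ, map_sum, Finset.sum_apply, Finset.sum_eq_single w]
      · rw [map_smul]; rfl
      · intro b _ hb; rw [map_smul]; simp [(hoff b w hb).2]
      · simp
    rw [hc] at e1 e2
    by_contra h
    simp only [Pi.zero_apply] at h
    apply hne w
    simp only [map_zero, Pi.zero_apply] at e1 e2
    exact ⟨(mul_eq_zero.1 e1.symm).resolve_left h, (mul_eq_zero.1 e2.symm).resolve_left h⟩
  have hiso0 : ∀ w w', omg B (res G B (u w)) (res G B (u w')) = 0 := by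
    intro w w'
    by_cases h : w = w'
    · subst h
      rw [omg_res]
      refine Finset.sum_eq_zero fun i _ => ?_
      rw [mul_comm]; exact CharTwo.add_self_eq_zero _
    · rw [omg_res, Finset.sum_subset (Finset.subset_univ B), omg_univ]
      intro i _ hi
      by_cases e : i = w.1
      · have := hoff w' w (Ne.symm h)
        rw [e]; simp [this.1, this.2]
      · have := hu w i (by simp [e, hi])
        simp [this.1, this.2]
  let Ψ := (res G B).comp Φ
  have hiso := isotropic_le B (LinearMap.range Ψ) (by
    rintro _ ⟨c, rfl⟩ _ ⟨d, rfl⟩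
    simp only [Ψ, LinearMap.comp_apply, hΦ, map_sum, map_smul, LinearMap.sum_apply,
      LinearMap.smul_apply, hiso0, smul_zero, Finset.sum_const_zero])
  have hrn := LinearMap.finrank_range_add_finrank_ker Ψ
  have hrn2 := LinearMap.finrank_range_add_finrank_ker (res G (insert v B))
  rw [res_surj G _ hA, finrank_top] at hrn2
  have hvz : ∀ c, Φ c v = 0 ∧ adjL G (Φ c) v = 0 := by
    intro c
    have : ∀ w : W, u w v = 0 ∧ adjL G (u w) v = 0 := fun w => hu w v (by
      have := w.2
      simp only [Finset.mem_insert, not_or] at this ⊢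
      exact ⟨fun e => this.1 e.symm, hv⟩)
    rw [hΦ]
    constructor
    · simp [Finset.sum_apply, (this _).1]
    · simp [map_sum, Finset.sum_apply, (this _).2]
  have hle : (LinearMap.ker Ψ).map Φ ≤ LinearMap.ker (res G (insert v B)) := by
    rintro _ ⟨c, hc, rfl⟩
    have hc' : res G B (Φ c) = 0 := hc
    rw [LinearMap.mem_ker]
    have h1 : ∀ i (h : i ∈ B), Φ c i = 0 := fun i h =>
      congrFun (congrArg Prod.fst hc') ⟨i, h⟩
    have h2 : ∀ i (h : i ∈ B), adjL G (Φ c) i = 0 := fun i h =>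
      congrFun (congrArg Prod.snd hc') ⟨i, h⟩
    refine Prod.ext (funext fun i => ?_) (funext fun i => ?_)
    · change Φ c i.1 = 0
      rcases Finset.mem_insert.1 i.2 with h | h
      · rw [h]; exact (hvz c).1
      · exact h1 _ h
    · change adjL G (Φ c) i.1 = 0
      rcases Finset.mem_insert.1 i.2 with h | h
      · rw [h]; exact (hvz c).2
      · exact h2 _ h
  have hfr := Submodule.finrank_mono hle
  rw [(Submodule.equivMapOfInjective Φ hinj (LinearMap.ker Ψ)).finrank_eq.symm] at hfr
  have hcW : Fintype.card W = Fintype.card V - (B.card + 1) := by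
    rw [Fintype.card_subtype_compl, Fintype.card_coe, Finset.card_insert_of_notMem hv]
  have hcA : B.card + 1 ≤ Fintype.card V := by
    rw [← Finset.card_insert_of_notMem hv]; exact Finset.card_le_univ _
  simp only [Module.finrank_prod, Module.finrank_fintype_fun_eq_card, Fintype.card_coe,
    Finset.card_insert_of_notMem hv] at hrn hrn2 hiso
  omega

theorem exists_of_step {V : Type*} [Fintype V] (G : SimpleGraph V) (v : V) (A : Finset V)
    (hA : Full G A) (hAv : ¬ Full G (insert v A)) :
    ∃ L : Finset V, IsMinimalLocalSet G L ∧ v ∈ L := by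
  obtain ⟨L, hL, hLs⟩ := (not_full_iff G _).1 hAv
  obtain ⟨M, hML, hM⟩ := exists_minimal_le_of_wellFoundedLT (fun L => IsLocalSet G L) L hL
  refine ⟨M, ⟨hM.1, fun L' h1 h2 => le_antisymm h2 (hM.2 h1 h2)⟩, ?_⟩
  by_contra hv
  refine (not_full_iff G A).2 ⟨M, hM.1, fun i hi => ?_⟩ hA
  rcases Finset.mem_insert.1 (hLs (hML hi)) with h | h
  · exact absurd (h ▸ hi) hv
  · exact h

/-- Every vertex of a finite simple graph belongs to some minimal local set. -/
theorem stmt_7 {V : Type*} [Fintype V] (G : SimpleGraph V) (v : V) :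
    ∃ L : Finset V, IsMinimalLocalSet G L ∧ v ∈ L := by
  have h0 : Full G ∅ := fun x hx => funext fun i => (hx i (by simp)).1
  obtain ⟨A, -, hA⟩ := exists_maximal_ge_of_wellFoundedGT (fun X => Full G X) ∅ h0
  have hmax : ∀ X, A.card < X.card → A ⊆ X → ¬ Full G X := fun X hc hs hf =>
    absurd (Finset.card_le_card (hA.2 hf hs)) (by omega)
  by_cases hv : v ∈ A
  · by_contra hno
    refine main_contra G (A.erase v) v (by simp) (by rw [Finset.insert_erase hv]; exact hA.1) ?_
    intro w hw hf
    rw [Finset.insert_erase hv] at hw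
    refine hno (exists_of_step G v _ hf ?_)
    rw [Finset.insert_comm, Finset.insert_erase hv]
    exact hmax _ (by rw [Finset.card_insert_of_notMem hw]; omega) (Finset.subset_insert _ _)
  · exact exists_of_step G v A hA.1
      (hmax _ (by rw [Finset.card_insert_of_notMem hv]; omega) (Finset.subset_insert _ _))
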